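/- arXiv:2406.17068 — 7 statements merged into one kernel-verified Lean document; each statement's English description precedes it below -/
import Mathlib

section
/- Let α ∈ ℝ, α ≠ 0, and let φ, ψ be real-valued functions with φ three times differentiable at τ, φ'(τ) ≠ 0, and ψ three times differentiable at φ(τ), ψ'(φ(τ)) ≠ 0. Assume that α·φ(τ) − α/2, α·ψ(φ(τ)) − α/2, and α·(ψ∘φ)(τ) − α/2 are each not of the form π/2 + kπ for any integer k, so that all three tangent compositions below are defined and three times differentiable near the relevant points. Then S(tan(α·(ψ∘φ)(·) − α/2), τ) = S(tan(α·φ(·) − α/2), τ) + ( S(tan(α·ψ(·) − α/2), φ(τ)) − 2α² ) · φ'(τ)². -/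
open Real Filter

/-- A real function is three times differentiable at a point `τ`. -/
def ThreeTimesDiffAt (f : ℝ → ℝ) (τ : ℝ) : Prop :=
  (∀ᶠ x in nhds τ, DifferentiableAt ℝ f x) ∧
  (∀ᶠ x in nhds τ, DifferentiableAt ℝ (deriv f) x) ∧
  DifferentiableAt ℝ (deriv (deriv f)) τ

/-- The Schwarzian derivative `S(f, τ) = f'''(τ)/f'(τ) − (3/2)(f''(τ)/f'(τ))²`. -/
noncomputable def schwarzian (f : ℝ → ℝ) (τ : ℝ) : ℝ :=
  deriv (deriv (deriv f)) τ / deriv f τ - (3 / 2) * (deriv (deriv f) τ / deriv f τ) ^ 2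

/-- The first two derivatives of a composition near a point, and the third one at the point. -/
theorem ThreeTimesDiffAt.comp_derivs {f g : ℝ → ℝ} {τ : ℝ}
    (hf : ThreeTimesDiffAt f (g τ)) (hg : ThreeTimesDiffAt g τ) :
    (∀ᶠ x in nhds τ, HasDerivAt (f ∘ g) (deriv f (g x) * deriv g x) x) ∧
    (∀ᶠ x in nhds τ, HasDerivAt (deriv (f ∘ g))
      (deriv (deriv f) (g x) * deriv g x ^ 2 + deriv f (g x) * deriv (deriv g) x) x) ∧
    HasDerivAt (deriv (deriv (f ∘ g)))
      (deriv (deriv (deriv f)) (g τ) * deriv g τ ^ 3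
        + 3 * deriv (deriv f) (g τ) * deriv g τ * deriv (deriv g) τ
        + deriv f (g τ) * deriv (deriv (deriv g)) τ) τ := by
  obtain ⟨f1, f2, f3⟩ := hf
  obtain ⟨g1, g2, g3⟩ := hg
  have hc : Tendsto g (nhds τ) (nhds (g τ)) := g1.self_of_nhds.continuousAt
  have h1 : ∀ᶠ x in nhds τ, HasDerivAt (f ∘ g) (deriv f (g x) * deriv g x) x := by
    filter_upwards [hc.eventually f1, g1] with x hfx hgx
    exact hfx.hasDerivAt.comp x hgx.hasDerivAt
  have h2 : ∀ᶠ x in nhds τ, HasDerivAt (deriv (f ∘ g))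
      (deriv (deriv f) (g x) * deriv g x ^ 2 + deriv f (g x) * deriv (deriv g) x) x := by
    filter_upwards [hc.eventually f2, g1, g2, h1.eventually_nhds] with x hfx hgx hgx' hx
    have h := (hfx.hasDerivAt.comp x hgx.hasDerivAt).mul hgx'.hasDerivAt
    refine (h.congr_of_eventuallyEq (hx.mono fun y hy => hy.deriv)).congr_deriv ?_
    simp only [Function.comp_apply]
    ring
  refine ⟨h1, h2, ?_⟩
  have hg0 := g1.self_of_nhds.hasDerivAt
  have hg1 := g2.self_of_nhds.hasDerivAt
  have h := ((f3.hasDerivAt.comp τ hg0).mul (hg1.pow 2)).add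
    ((f2.self_of_nhds.hasDerivAt.comp τ hg0).mul g3.hasDerivAt)
  refine (h.congr_of_eventuallyEq (h2.mono fun y hy => hy.deriv)).congr_deriv ?_
  simp only [Function.comp_apply, Pi.pow_apply]
  push_cast
  ring

theorem ThreeTimesDiffAt.comp {f g : ℝ → ℝ} {τ : ℝ}
    (hf : ThreeTimesDiffAt f (g τ)) (hg : ThreeTimesDiffAt g τ) :
    ThreeTimesDiffAt (f ∘ g) τ := by
  obtain ⟨h1, h2, h3⟩ := hf.comp_derivs hg
  exact ⟨h1.mono fun _ h => h.differentiableAt, h2.mono fun _ h => h.differentiableAt,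
    h3.differentiableAt⟩

/-- The chain rule for the Schwarzian derivative. -/
theorem schwarzian_comp {f g : ℝ → ℝ} {τ : ℝ}
    (hf : ThreeTimesDiffAt f (g τ)) (hg : ThreeTimesDiffAt g τ)
    (hf' : deriv f (g τ) ≠ 0) (hg' : deriv g τ ≠ 0) :
    schwarzian (f ∘ g) τ = schwarzian g τ + schwarzian f (g τ) * deriv g τ ^ 2 := by
  obtain ⟨h1, h2, h3⟩ := hf.comp_derivs hg
  unfold schwarzian
  rw [h1.self_of_nhds.deriv, h2.self_of_nhds.deriv, h3.deriv]
  field_simp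
  ring

theorem hasDerivAt_tan_affine (a b : ℝ) {x : ℝ} (hx : Real.cos (a * x - b) ≠ 0) :
    HasDerivAt (fun t => Real.tan (a * t - b)) (a * (1 + Real.tan (a * x - b) ^ 2)) x := by
  have h := (Real.hasDerivAt_tan hx).comp x (((hasDerivAt_id x).const_mul a).sub_const b)
  refine h.congr_deriv ?_
  rw [← Real.inv_one_add_tan_sq hx]
  simp [mul_comm]

/-- The first three derivatives of `t ↦ tan (a * t - b)`. -/
theorem tan_affine_derivs (a b : ℝ) {x : ℝ} (hx : Real.cos (a * x - b) ≠ 0) :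
    (∀ᶠ y in nhds x, HasDerivAt (fun t => Real.tan (a * t - b))
      (a * (1 + Real.tan (a * y - b) ^ 2)) y) ∧
    (∀ᶠ y in nhds x, HasDerivAt (deriv fun t => Real.tan (a * t - b))
      (2 * a ^ 2 * (Real.tan (a * y - b) + Real.tan (a * y - b) ^ 3)) y) ∧
    HasDerivAt (deriv (deriv fun t => Real.tan (a * t - b)))
      (2 * a ^ 3 * (1 + 3 * Real.tan (a * x - b) ^ 2) * (1 + Real.tan (a * x - b) ^ 2)) x := by
  have hcos : ∀ᶠ y in nhds x, Real.cos (a * y - b) ≠ 0 :=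
    ContinuousAt.eventually_ne (by fun_prop) hx
  have h1 : ∀ᶠ y in nhds x, HasDerivAt (fun t => Real.tan (a * t - b))
      (a * (1 + Real.tan (a * y - b) ^ 2)) y :=
    hcos.mono fun y hy => hasDerivAt_tan_affine a b hy
  have h2 : ∀ᶠ y in nhds x, HasDerivAt (deriv fun t => Real.tan (a * t - b))
      (2 * a ^ 2 * (Real.tan (a * y - b) + Real.tan (a * y - b) ^ 3)) y := by
    filter_upwards [h1.eventually_nhds] with y hy
    have h := ((hy.self_of_nhds.pow 2).const_add 1).const_mul a
    refine (h.congr_of_eventuallyEq (hy.mono fun z hz => hz.deriv)).congr_deriv ?_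
    push_cast
    ring
  refine ⟨h1, h2, ?_⟩
  have h0 := h1.self_of_nhds
  have h := (h0.add (h0.pow 3)).const_mul (2 * a ^ 2)
  refine (h.congr_of_eventuallyEq (h2.mono fun z hz => hz.deriv)).congr_deriv ?_
  push_cast
  ring

theorem threeTimesDiffAt_tan_affine (a b : ℝ) {x : ℝ} (hx : Real.cos (a * x - b) ≠ 0) :
    ThreeTimesDiffAt (fun t => Real.tan (a * t - b)) x := by
  obtain ⟨h1, h2, h3⟩ := tan_affine_derivs a b hx
  exact ⟨h1.mono fun _ h => h.differentiableAt, h2.mono fun _ h => h.differentiableAt,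
    h3.differentiableAt⟩

theorem deriv_tan_affine_ne_zero {a : ℝ} (ha : a ≠ 0) (b : ℝ) {x : ℝ}
    (hx : Real.cos (a * x - b) ≠ 0) : deriv (fun t => Real.tan (a * t - b)) x ≠ 0 := by
  rw [(hasDerivAt_tan_affine a b hx).deriv]
  positivity

theorem schwarzian_tan_affine {a : ℝ} (ha : a ≠ 0) (b : ℝ) {x : ℝ}
    (hx : Real.cos (a * x - b) ≠ 0) :
    schwarzian (fun t => Real.tan (a * t - b)) x = 2 * a ^ 2 := by
  obtain ⟨h1, h2, h3⟩ := tan_affine_derivs a b hx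
  unfold schwarzian
  rw [h1.self_of_nhds.deriv, h2.self_of_nhds.deriv, h3.deriv]
  have : 1 + Real.tan (a * x - b) ^ 2 ≠ 0 := by positivity
  field_simp
  ring

theorem cos_ne_zero_of_forall_ne {x : ℝ} (hx : ∀ k : ℤ, x ≠ π / 2 + k * π) :
    Real.cos x ≠ 0 := by
  rw [Real.cos_ne_zero_iff]
  intro k h
  exact hx k (by rw [h]; ring)

/-- `S(tan(α·(ψ∘φ)(·) − α/2), τ)
  = S(tan(α·φ(·) − α/2), τ) + (S(tan(α·ψ(·) − α/2), φ(τ)) − 2α²)·φ'(τ)²`. -/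
theorem schwarzian_tan_chain (α : ℝ) (hα : α ≠ 0) (φ ψ : ℝ → ℝ) (τ : ℝ)
    (hφ : ThreeTimesDiffAt φ τ) (hφ' : deriv φ τ ≠ 0)
    (hψ : ThreeTimesDiffAt ψ (φ τ)) (hψ' : deriv ψ (φ τ) ≠ 0)
    (hdomφ : ∀ k : ℤ, α * φ τ - α / 2 ≠ π / 2 + k * π)
    (hdomψ : ∀ k : ℤ, α * ψ (φ τ) - α / 2 ≠ π / 2 + k * π)
    (hdomψφ : ∀ k : ℤ, α * (ψ ∘ φ) τ - α / 2 ≠ π / 2 + k * π) :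
    schwarzian (fun t => Real.tan (α * (ψ ∘ φ) t - α / 2)) τ
      = schwarzian (fun t => Real.tan (α * φ t - α / 2)) τ
        + (schwarzian (fun t => Real.tan (α * ψ t - α / 2)) (φ τ) - 2 * α ^ 2)
          * (deriv φ τ) ^ 2 := by
  have cφ := cos_ne_zero_of_forall_ne hdomφ
  have cψ := cos_ne_zero_of_forall_ne hdomψ
  have hTψ := threeTimesDiffAt_tan_affine α (α / 2) cψ
  have dψ : deriv ((fun t => Real.tan (α * t - α / 2)) ∘ ψ) (φ τ) ≠ 0 := by
    rw [(hTψ.comp_derivs hψ).1.self_of_nhds.deriv]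
    exact mul_ne_zero (deriv_tan_affine_ne_zero hα _ cψ) hψ'
  have e1 := schwarzian_comp (hTψ.comp hψ) hφ dψ hφ'
  have e2 := schwarzian_comp (threeTimesDiffAt_tan_affine α (α / 2) cφ) hφ
    (deriv_tan_affine_ne_zero hα _ cφ) hφ'
  rw [schwarzian_tan_affine hα _ cφ] at e2
  simp only [Function.comp_def] at e1 e2 ⊢
  rw [e1, e2]
  ring
end

section
/- For every σ² > 0, the integral ∫₀^∞ exp(−σ²k²/2)·sinh(2πk)·2k dk converges and equals (2π/σ²)^{3/2}·exp(2π²/σ²); moreover it also equals ∫₀^∞ exp(−σ²E)·sinh(2π√(2E))·2 dE. -/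
open Real MeasureTheory Set

theorem neg_mul_sq_add_mul_eq {b : ℝ} (hb : b ≠ 0) (c x : ℝ) :
    -b * x ^ 2 + c * x = c ^ 2 / (4 * b) + -b * (x - c / (2 * b)) ^ 2 := by
  field_simp
  ring

theorem integrable_mul_exp_neg_mul_sq_add_mul {b : ℝ} (hb : 0 < b) (c : ℝ) :
    Integrable fun x : ℝ => x * exp (-b * x ^ 2 + c * x) := by
  have h := (((integrable_mul_exp_neg_mul_sq hb).add
    ((integrable_exp_neg_mul_sq hb).const_mul (c / (2 * b)))).const_mul
      (exp (c ^ 2 / (4 * b)))).comp_sub_right (c / (2 * b))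
  refine h.congr (.of_forall fun x => ?_)
  simp only [Pi.add_apply]
  rw [neg_mul_sq_add_mul_eq hb.ne', exp_add]
  ring

theorem integral_mul_exp_neg_mul_sq_add_mul {b : ℝ} (hb : 0 < b) (c : ℝ) :
    ∫ x : ℝ, x * exp (-b * x ^ 2 + c * x) =
      exp (c ^ 2 / (4 * b)) * (c / (2 * b) * √(π / b)) := by
  have hodd : ∫ x : ℝ, x * exp (-b * x ^ 2) = 0 := by
    have h := integral_neg_eq_self (fun x : ℝ => x * exp (-b * x ^ 2)) volume
    simp only [neg_sq, neg_mul, integral_neg] at h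
    simp only [neg_mul]
    linarith
  have hexp (x : ℝ) : x * exp (-b * x ^ 2 + c * x) = exp (c ^ 2 / (4 * b)) *
      ((x - c / (2 * b)) * exp (-b * (x - c / (2 * b)) ^ 2) +
        c / (2 * b) * exp (-b * (x - c / (2 * b)) ^ 2)) := by
    rw [neg_mul_sq_add_mul_eq hb.ne', exp_add]
    ring
  rw [integral_congr_ae (.of_forall hexp)]
  refine (integral_sub_right_eq_self (μ := volume) (fun y : ℝ => exp (c ^ 2 / (4 * b)) *
    (y * exp (-b * y ^ 2) + c / (2 * b) * exp (-b * y ^ 2))) (c / (2 * b))).trans ?_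
  rw [integral_const_mul,
    integral_add (integrable_mul_exp_neg_mul_sq hb)
      ((integrable_exp_neg_mul_sq hb).const_mul _),
    integral_const_mul, hodd, integral_gaussian, zero_add]

theorem integrableOn_Ioi_exp_mul_sinh_mul {b : ℝ} (hb : 0 < b) (c : ℝ) :
    IntegrableOn (fun k : ℝ => exp (-b * k ^ 2) * sinh (c * k) * (2 * k)) (Ioi 0) := by
  have h := integrable_mul_exp_neg_mul_sq_add_mul hb c
  refine (h.add h.comp_neg).integrableOn.congr_fun (fun k _ => ?_) measurableSet_Ioi
  simp only [Pi.add_apply, neg_sq, exp_add, mul_neg, sinh_eq]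
  ring

theorem integral_Ioi_exp_mul_sinh_mul {b : ℝ} (hb : 0 < b) (c : ℝ) :
    ∫ k in Ioi (0 : ℝ), exp (-b * k ^ 2) * sinh (c * k) * (2 * k) =
      exp (c ^ 2 / (4 * b)) * (c / (2 * b) * √(π / b)) := by
  have h := integrable_mul_exp_neg_mul_sq_add_mul hb c
  rw [← integral_mul_exp_neg_mul_sq_add_mul hb c,
    ← intervalIntegral.integral_Iic_add_Ioi (b := 0) h.integrableOn h.integrableOn]
  have hneg := integral_comp_neg_Ioi (0 : ℝ) (fun x : ℝ => x * exp (-b * x ^ 2 + c * x))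
  rw [neg_zero] at hneg
  rw [← hneg, ← integral_add h.comp_neg.integrableOn h.integrableOn]
  congr 1 with k
  simp only [neg_sq, exp_add, mul_neg, sinh_eq]
  ring

theorem image_sq_div_two_Ioi : (fun k : ℝ => k ^ 2 / 2) '' Ioi 0 = Ioi 0 := by
  ext E
  constructor
  · rintro ⟨k, hk, rfl⟩
    have : 0 < k := hk
    simp only [mem_Ioi]
    positivity
  · intro hE
    have : 0 < E := hE
    refine ⟨√(2 * E), sqrt_pos.2 (by positivity), ?_⟩
    simp only
    rw [sq_sqrt (by positivity)]
    ring

theorem injOn_sq_div_two_Ioi : InjOn (fun k : ℝ => k ^ 2 / 2) (Ioi 0) := by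
  intro x hx y hy h
  have hx : 0 < x := hx
  have hy : 0 < y := hy
  simp only at h
  nlinarith

theorem hasDerivWithinAt_sq_div_two (s : Set ℝ) (k : ℝ) :
    HasDerivWithinAt (fun k : ℝ => k ^ 2 / 2) k s k := by
  have h := ((hasDerivAt_pow 2 k).div_const 2).hasDerivWithinAt (s := s)
  convert! h using 1
  simp



/-- The partition function of the Schwarzian Field Theory:
for σ² > 0, `∫₀^∞ exp(−σ²k²/2)·sinh(2πk)·2k dk` converges, equals
`(2π/σ²)^{3/2}·exp(2π²/σ²)`, and also equals
`∫₀^∞ exp(−σ²E)·sinh(2π√(2E))·2 dE`. -/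
theorem schwarzian_partition_function (σ2 : ℝ) (hσ2 : 0 < σ2) :
    IntegrableOn (fun k : ℝ => Real.exp (-(σ2 * k ^ 2) / 2) * Real.sinh (2 * π * k) * (2 * k))
      (Ioi 0) ∧
    IntegrableOn (fun E : ℝ => Real.exp (-(σ2 * E)) * Real.sinh (2 * π * Real.sqrt (2 * E)) * 2)
      (Ioi 0) ∧
    (∫ k in Ioi (0 : ℝ), Real.exp (-(σ2 * k ^ 2) / 2) * Real.sinh (2 * π * k) * (2 * k))
      = (2 * π / σ2) ^ ((3 : ℝ) / 2) * Real.exp (2 * π ^ 2 / σ2) ∧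
    (∫ k in Ioi (0 : ℝ), Real.exp (-(σ2 * k ^ 2) / 2) * Real.sinh (2 * π * k) * (2 * k))
      = ∫ E in Ioi (0 : ℝ), Real.exp (-(σ2 * E)) * Real.sinh (2 * π * Real.sqrt (2 * E)) * 2 := by
  have hb : 0 < σ2 / 2 := by positivity
  have hform : (fun k : ℝ => exp (-(σ2 * k ^ 2) / 2) * sinh (2 * π * k) * (2 * k)) =
      fun k => exp (-(σ2 / 2) * k ^ 2) * sinh (2 * π * k) * (2 * k) := by
    ext k
    ring_nf
  have hint := integrableOn_Ioi_exp_mul_sinh_mul hb (2 * π)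
  have hval := integral_Ioi_exp_mul_sinh_mul hb (2 * π)
  rw [← hform] at hint hval
  have hsubst : EqOn (fun k : ℝ => exp (-(σ2 * k ^ 2) / 2) * sinh (2 * π * k) * (2 * k))
      (fun k => |k| • (exp (-(σ2 * (k ^ 2 / 2))) * sinh (2 * π * √(2 * (k ^ 2 / 2))) * 2))
      (Ioi 0) := by
    intro k hk
    have hk : 0 < k := hk
    simp only [smul_eq_mul]
    rw [abs_of_pos hk, mul_div_cancel₀ _ two_ne_zero, sqrt_sq hk.le, neg_div, mul_div_assoc]
    ring
  have hderiv (k : ℝ) (_ : k ∈ Ioi (0 : ℝ)) := hasDerivWithinAt_sq_div_two (Ioi 0) k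
  refine ⟨hint, ?_, ?_, ?_⟩
  · rw [← image_sq_div_two_Ioi, integrableOn_image_iff_integrableOn_abs_deriv_smul
      measurableSet_Ioi hderiv injOn_sq_div_two_Ioi]
    exact hint.congr_fun hsubst measurableSet_Ioi
  · have hm : 0 < 2 * π / σ2 := by positivity
    have h₁ : (2 * π) ^ 2 / (4 * (σ2 / 2)) = 2 * π ^ 2 / σ2 := by
      field_simp
      ring
    have h₂ : 2 * π / (2 * (σ2 / 2)) = 2 * π / σ2 := by field_simp
    have h₃ : π / (σ2 / 2) = 2 * π / σ2 := by field_simp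
    rw [hval, h₁, h₂, h₃, show (3 : ℝ) / 2 = 1 + 1 / 2 by norm_num, rpow_add hm, rpow_one,
      sqrt_eq_rpow, mul_comm]
  · conv_rhs => rw [← image_sq_div_two_Ioi]
    rw [integral_image_eq_integral_abs_deriv_smul measurableSet_Ioi hderiv injOn_sq_div_two_Ioi]
    exact setIntegral_congr_fun measurableSet_Ioi hsubst
end

section
/- Let 0 < α < π and define f_α: [0,1] → ℝ by f_α(t) = (1/2)·( tan(α(t − 1/2))/tan(α/2) + 1 ). Then f_α is smooth on [0,1], f_α(0) = 0, f_α(1) = 1, f_α'(t) > 0 for all t ∈ [0,1], the Schwarzian derivative satisfies S(f_α, t) = 2α² for all t ∈ [0,1], the boundary derivatives satisfy f_α'(0) = f_α'(1) = α/sin(α), and the boundary second derivatives satisfy −f_α''(0)/f_α'(0) = f_α''(1)/f_α'(1) = 2α·tan(α/2). -/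
open Real

/-- On `cos (α (t - 1/2)) ≠ 0`, the function `t ↦ tan (α (t - 1/2))` solves `u' = α (1 + u²)`. -/
lemma hasDerivAt_tan_mul_sub_half {α t : ℝ} (ht : cos (α * (t - 1 / 2)) ≠ 0) :
    HasDerivAt (fun s => tan (α * (s - 1 / 2))) (α * (1 + tan (α * (t - 1 / 2)) ^ 2)) t := by
  have h : HasDerivAt (fun s : ℝ => α * (s - 1 / 2)) (α * 1) t :=
    ((hasDerivAt_id t).sub_const _).const_mul α
  refine (HasDerivAt.comp (h₂ := tan) t (hasDerivAt_tan ht) h).congr_deriv ?_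
  rw [tan_eq_sin_div_cos]
  generalize α * (t - 1 / 2) = x at ht ⊢
  field_simp
  rw [cos_sq_add_sin_sq, mul_one]

/-- If `f` agrees on an open set with a function `g` whose derivative there is `g'`, then `deriv f`
agrees with `g'` on that set. -/
lemma eqOn_deriv_of_eqOn {U : Set ℝ} (hU : IsOpen U) {f g g' : ℝ → ℝ} (hfg : Set.EqOn f g U)
    (hg : ∀ t ∈ U, HasDerivAt g (g' t) t) : Set.EqOn (deriv f) g' U := fun t ht =>
  ((hfg.eventuallyEq_of_mem (hU.mem_nhds ht)).deriv_eq).trans (hg t ht).deriv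

/-- Properties of the boundary-defect map
`f_α(t) = (1/2)(tan(α(t − 1/2))/tan(α/2) + 1)` for `0 < α < π`:
it is smooth on `[0,1]`, fixes `0` and `1`, is strictly increasing,
has constant Schwarzian `2α²`, boundary derivatives `α/sin α`, and boundary
log-derivatives `∓2α·tan(α/2)`. -/
theorem boundary_defect_map_properties (α : ℝ) (h0 : 0 < α) (hπ : α < π)
    (f : ℝ → ℝ) (hf : ∀ t, f t = (1 / 2) * (Real.tan (α * (t - 1 / 2)) / Real.tan (α / 2) + 1)) :
    ContDiffOn ℝ (⊤ : ℕ∞) f (Set.Icc 0 1) ∧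
    f 0 = 0 ∧ f 1 = 1 ∧
    (∀ t ∈ Set.Icc (0 : ℝ) 1, 0 < deriv f t) ∧
    (∀ t ∈ Set.Icc (0 : ℝ) 1, schwarzian f t = 2 * α ^ 2) ∧
    deriv f 0 = α / Real.sin α ∧ deriv f 1 = α / Real.sin α ∧
    -(deriv (deriv f) 0 / deriv f 0) = 2 * α * Real.tan (α / 2) ∧
    deriv (deriv f) 1 / deriv f 1 = 2 * α * Real.tan (α / 2) := by
  have hα : 0 < sin (α / 2) := sin_pos_of_pos_of_lt_pi (by linarith) (by linarith)
  have hα' : 0 < cos (α / 2) := cos_pos_of_mem_Ioo ⟨by linarith, by linarith⟩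
  have hT : 0 < tan (α / 2) := tan_pos_of_pos_of_lt_pi_div_two (by linarith) (by linarith)
  set T := tan (α / 2) with hT_def
  set U : Set ℝ := {t | cos (α * (t - 1 / 2)) ≠ 0} with hU_def
  have hU : IsOpen U := isOpen_ne_fun (by fun_prop) continuous_const
  have hIcc : Set.Icc (0 : ℝ) 1 ⊆ U := fun t ht =>
    (cos_pos_of_mem_Ioo ⟨by nlinarith [ht.1, ht.2], by nlinarith [ht.1, ht.2]⟩).ne'
  set u : ℝ → ℝ := fun t => tan (α * (t - 1 / 2)) with hu_def
  have hu : ∀ t ∈ U, HasDerivAt u (α * (1 + u t ^ 2)) t := fun t ht =>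
    hasDerivAt_tan_mul_sub_half ht
  have hu0 : u 0 = -T := by
    rw [hT_def, ← tan_neg]
    simp only [hu_def]
    congr 1
    ring
  have hu1 : u 1 = T := by
    simp only [hu_def, hT_def]
    congr 1
    ring
  have d1 : Set.EqOn (deriv f) (fun t => α / (2 * T) * (1 + u t ^ 2)) U := by
    refine eqOn_deriv_of_eqOn hU (g := fun t => 1 / 2 * (u t / T + 1)) (fun t _ => hf t)
      fun t ht => ?_
    refine HasDerivAt.congr_deriv ((((hu t ht).div_const T).add_const 1).const_mul (1 / 2)) ?_
    field_simp
  have d2 : Set.EqOn (deriv (deriv f)) (fun t => α ^ 2 / T * (u t * (1 + u t ^ 2))) U := by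
    refine eqOn_deriv_of_eqOn hU d1 fun t ht => ?_
    refine HasDerivAt.congr_deriv ((((hu t ht).pow 2).const_add 1).const_mul (α / (2 * T))) ?_
    push_cast
    field_simp
  have d3 : Set.EqOn (deriv (deriv (deriv f)))
      (fun t => α ^ 3 / T * ((1 + 3 * u t ^ 2) * (1 + u t ^ 2))) U := by
    refine eqOn_deriv_of_eqOn hU d2 fun t ht => ?_
    refine HasDerivAt.congr_deriv
      (((hu t ht).mul (((hu t ht).pow 2).const_add 1)).const_mul (α ^ 2 / T)) ?_
    simp only [Pi.pow_apply]
    push_cast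
    field_simp
    ring
  have hpos : ∀ t, 0 < 1 + u t ^ 2 := fun t => by positivity
  have hlog : ∀ t ∈ U, deriv (deriv f) t / deriv f t = 2 * α * u t := fun t ht => by
    rw [d1 ht, d2 ht]
    have := (hpos t).ne'
    field_simp
  have hbdry : α / (2 * T) * (1 + T ^ 2) = α / sin α := by
    have hsin : sin α = 2 * sin (α / 2) * cos (α / 2) := by
      rw [← sin_two_mul]
      congr 1
      ring
    rw [hsin, hT_def, tan_eq_sin_div_cos]
    field_simp
    exact cos_sq_add_sin_sq _
  have m0 : (0 : ℝ) ∈ U := hIcc (by simp)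
  have m1 : (1 : ℝ) ∈ U := hIcc (by simp)
  refine ⟨?_, ?_, ?_, ?_, ?_, ?_, ?_, ?_, ?_⟩
  · intro t ht
    rw [funext hf]
    have h : ContDiffAt ℝ (⊤ : ℕ∞) u t :=
      ContDiffAt.comp (g := tan) (f := fun t => α * (t - 1 / 2)) t
        (contDiffAt_tan.2 (hIcc ht)) (by fun_prop)
    exact (contDiffAt_const.mul ((h.div_const T).add contDiffAt_const)).contDiffWithinAt
  · rw [hf]
    change 1 / 2 * (u 0 / T + 1) = 0
    rw [hu0]
    field_simp
    ring
  · rw [hf]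
    change 1 / 2 * (u 1 / T + 1) = 1
    rw [hu1]
    field_simp
    ring
  · intro t ht
    rw [d1 (hIcc ht)]
    exact mul_pos (by positivity) (hpos t)
  · intro t ht
    rw [schwarzian, hlog t (hIcc ht), d1 (hIcc ht), d3 (hIcc ht)]
    have := (hpos t).ne'
    field_simp
    ring
  · rw [d1 m0, ← hbdry]
    simp [hu0]
  · rw [d1 m1, ← hbdry]
    simp [hu1]
  · rw [hlog 0 m0, hu0]
    ring
  · rw [hlog 1 m1, hu1]
end

section
/- Let P be a nonnegative Borel measure on [0, ∞). Assume there exists ε > 0 such that the exponential moment F(z) = ∫ exp(z·X) dP(X) is finite for all z ∈ [0, ε). Assume further that there exist R > 0 and an analytic function G on the open complex disk D_R = {z ∈ ℂ : |z| < R} such that G(z) = F(z) for all real z ∈ [0, min(ε, R)). Then for every z ∈ D_R the integral ∫ exp(z·X) dP(X) converges absolutely and equals G(z). -/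
open MeasureTheory Metric

open ProbabilityTheory Filter Topology

/-- If the exponential series of the moments of a nonnegative random variable converges at `r ≥ 0`,
then the exponential moment at `r` is finite. -/
lemma integrable_exp_mul_of_summable_moments {Ω : Type*} {m : MeasurableSpace Ω} {μ : Measure Ω}
    {X : Ω → ℝ} (hX : AEMeasurable X μ) (hX0 : 0 ≤ᵐ[μ] X) {r : ℝ} (hr : 0 ≤ r)
    (hXint : ∀ n : ℕ, Integrable (fun ω ↦ X ω ^ n) μ)
    (hs : Summable fun n : ℕ ↦ r ^ n / (n.factorial : ℝ) * ∫ ω, X ω ^ n ∂μ) :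
    Integrable (fun ω ↦ Real.exp (r * X ω)) μ := by
  refine ⟨by fun_prop, ?_⟩
  rw [hasFiniteIntegral_iff_ofReal (.of_forall fun ω ↦ (Real.exp_pos _).le)]
  have hexp : ∀ᵐ ω ∂μ, ENNReal.ofReal (Real.exp (r * X ω)) =
      ∑' n : ℕ, ENNReal.ofReal (r ^ n / (n.factorial : ℝ) * X ω ^ n) := by
    filter_upwards [hX0] with ω hω
    have hω' : 0 ≤ X ω := hω
    have h := NormedSpace.expSeries_div_hasSum_exp (r * X ω)
    rw [← Real.exp_eq_exp_ℝ] at h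
    simp_rw [mul_pow, mul_div_right_comm] at h
    rw [← h.tsum_eq, ENNReal.ofReal_tsum_of_nonneg (fun n ↦ by positivity) h.summable]
  have hterm (n : ℕ) : ∫⁻ ω, ENNReal.ofReal (r ^ n / (n.factorial : ℝ) * X ω ^ n) ∂μ =
      ENNReal.ofReal (r ^ n / (n.factorial : ℝ) * ∫ ω, X ω ^ n ∂μ) := by
    rw [← integral_const_mul, ofReal_integral_eq_lintegral_ofReal ((hXint n).const_mul _)]
    filter_upwards [hX0] with ω hω
    have hω' : 0 ≤ X ω := hω
    show 0 ≤ r ^ n / (n.factorial : ℝ) * X ω ^ n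
    positivity
  rw [lintegral_congr_ae hexp, lintegral_tsum fun n ↦ by fun_prop]
  simp_rw [hterm]
  exact hs.tsum_ofReal_lt_top

/-- If the complex moment generating function of a nonnegative random variable agrees near `0` with
a function holomorphic on the disk of radius `R`, then the exponential moments are finite on
`[0, R)`. -/
lemma integrable_exp_mul_of_complexMGF_eventuallyEq {Ω : Type*} {m : MeasurableSpace Ω}
    {μ : Measure Ω} {X : Ω → ℝ} (hX0 : 0 ≤ᵐ[μ] X) (h0 : 0 ∈ interior (integrableExpSet X μ))
    {R : ℝ} {G : ℂ → ℂ} (hG : DifferentiableOn ℂ G (ball (0 : ℂ) R))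
    (hGX : complexMGF X μ =ᶠ[𝓝 0] G) {r : ℝ} (hr : 0 ≤ r) (hrR : r < R) :
    Integrable (fun ω ↦ Real.exp (r * X ω)) μ := by
  refine integrable_exp_mul_of_summable_moments (aemeasurable_of_mem_interior_integrableExpSet h0)
    hX0 hr (integrable_pow_of_mem_interior_integrableExpSet h0) ?_
  have hmom (n : ℕ) : iteratedDeriv n G 0 = ((∫ ω, X ω ^ n ∂μ : ℝ) : ℂ) := by
    rw [← (hGX.iteratedDeriv n).eq_of_nhds, iteratedDeriv_complexMGF (by simpa using h0),
      ← integral_complex_ofReal]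
    simp
  have hr_mem : (r : ℂ) ∈ ball (0 : ℂ) R := by simpa [abs_of_nonneg hr] using hrR
  have h := (Complex.hasSum_taylorSeries_on_ball hG hr_mem).summable
  simp_rw [hmom] at h
  refine Complex.summable_ofReal.mp (h.congr fun n ↦ ?_)
  simp only [sub_zero, smul_eq_mul]
  push_cast
  ring

/-- A nonnegative random variable with a finite exponential moment at `b` has finite exponential
moments at all `t ≤ b`. -/
lemma integrable_exp_mul_of_le_of_nonneg {Ω : Type*} {m : MeasurableSpace Ω}
    {μ : Measure Ω} {X : Ω → ℝ} (hX : AEMeasurable X μ) (hX0 : 0 ≤ᵐ[μ] X) {t b : ℝ} (htb : t ≤ b)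
    (hb : Integrable (fun ω ↦ Real.exp (b * X ω)) μ) :
    Integrable (fun ω ↦ Real.exp (t * X ω)) μ := by
  refine hb.mono' (by fun_prop) ?_
  filter_upwards [hX0] with ω hω
  rw [Real.norm_eq_abs, Real.abs_exp]
  exact Real.exp_le_exp.mpr (mul_le_mul_of_nonneg_right htb hω)

/-- Analytic continuation of the exponential moment generating function of a
nonnegative measure supported on `[0, ∞)`: if `F(z) = ∫ e^{zX} dP(X)` is finite for
real `z ∈ [0, ε)` and admits an analytic continuation `G` to the disk `D_R`, then
for every `z ∈ D_R` the integral `∫ e^{zX} dP(X)` converges absolutely and equals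
`G(z)`. -/
theorem analytic_continuation_exponential_moments
    (P : Measure ℝ) (hsupp : P {x : ℝ | x < 0} = 0)
    (ε : ℝ) (hε : 0 < ε)
    (hInt : ∀ z : ℝ, 0 ≤ z → z < ε → Integrable (fun X : ℝ => Real.exp (z * X)) P)
    (R : ℝ) (hR : 0 < R) (G : ℂ → ℂ)
    (hG : DifferentiableOn ℂ G (ball (0 : ℂ) R))
    (hagree : ∀ z : ℝ, 0 ≤ z → z < min ε R →
      G (z : ℂ) = ((∫ X : ℝ, Real.exp (z * X) ∂P : ℝ) : ℂ)) :
    ∀ z ∈ ball (0 : ℂ) R,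
      Integrable (fun X : ℝ => Complex.exp (z * (X : ℂ))) P ∧
      ∫ X : ℝ, Complex.exp (z * (X : ℂ)) ∂P = G z := by
  have hP0 : 0 ≤ᵐ[P] (id : ℝ → ℝ) := by
    simpa [EventuallyLE, ae_iff, not_le] using hsupp
  have hset {b : ℝ} (h : ∀ t, 0 ≤ t → t < b → Integrable (fun X : ℝ => Real.exp (t * X)) P)
      (hb : 0 < b) : Set.Iio b ⊆ interior (integrableExpSet id P) := by
    refine interior_maximal (fun t ht ↦ ?_) isOpen_Iio
    exact integrable_exp_mul_of_le_of_nonneg aemeasurable_id hP0 (le_max_left t 0)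
      (h _ (le_max_right t 0) (max_lt ht hb))
  have h0 : 0 ∈ interior (integrableExpSet id P) := hset hInt hε hε
  have hGan : AnalyticOnNhd ℂ G (ball 0 R) := hG.analyticOnNhd isOpen_ball
  have hfreq : ∃ᶠ z in 𝓝[≠] (0 : ℂ), complexMGF id P z = G z := by
    have hmap : Tendsto (fun x : ℝ ↦ (x : ℂ)) (𝓝[>] 0) (𝓝[≠] 0) := by
      refine tendsto_nhdsWithin_iff.mpr ⟨?_, ?_⟩
      · exact (Complex.continuous_ofReal.tendsto' 0 0 (by simp)).mono_left nhdsWithin_le_nhds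
      · filter_upwards [self_mem_nhdsWithin] with x hx
        simpa using (Set.mem_Ioi.mp hx).ne'
    refine hmap.frequently (Eventually.frequently ?_)
    filter_upwards [Ioo_mem_nhdsGT (lt_min hε hR)] with x hx
    rw [hagree x hx.1.le hx.2, complexMGF_ofReal]
    rfl
  have hnear : complexMGF id P =ᶠ[𝓝 0] G :=
    ((analyticAt_complexMGF (by simpa using h0)).frequently_eq_iff_eventually_eq
      (hGan 0 (mem_ball_self hR))).mp hfreq
  have hsetR : Set.Iio R ⊆ interior (integrableExpSet id P) :=
    hset (fun t ht htR ↦ integrable_exp_mul_of_complexMGF_eventuallyEq hP0 h0 hG hnear ht htR) hR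
  have hre {z : ℂ} (hz : z ∈ ball (0 : ℂ) R) : z.re ∈ interior (integrableExpSet id P) :=
    hsetR ((Complex.re_le_norm z).trans_lt (by simpa using hz))
  have heq : Set.EqOn (complexMGF id P) G (ball 0 R) :=
    AnalyticOnNhd.eqOn_of_preconnected_of_eventuallyEq (fun z hz ↦ analyticAt_complexMGF (hre hz))
      hGan (convex_ball 0 R).isPreconnected (mem_ball_self hR) hnear
  exact fun z hz ↦ ⟨integrable_cexp_mul_of_re_mem_interior_integrableExpSet (hre hz), heq hz⟩
end

section
/- Let h: [0,1] → ℝ be three times continuously differentiable with h'(t) > 0 for all t ∈ [0,1], h'(0) = h'(1), and h''(0) = h''(1). Then ∫₀¹ S(h, τ)/h'(τ) dτ = (1/2)·∫₀¹ h''(τ)²/h'(τ)³ dτ. -/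
open Real Set

/-- The Schwarzian derivative within a set, computed with one-sided (within-set)
derivatives: `S(f, τ) = f'''(τ)/f'(τ) − (3/2)(f''(τ)/f'(τ))²`. -/
noncomputable def schwarzianWithin (f : ℝ → ℝ) (s : Set ℝ) (τ : ℝ) : ℝ :=
  derivWithin (derivWithin (derivWithin f s) s) s τ / derivWithin f s τ
    - (3 / 2) * (derivWithin (derivWithin f s) s τ / derivWithin f s τ) ^ 2

/-- For a `C³` map `h` of `[0,1]` with `h' > 0`, `h'(0) = h'(1)` and `h''(0) = h''(1)`,
`∫₀¹ S(h,τ)/h'(τ) dτ = (1/2)·∫₀¹ h''(τ)²/h'(τ)³ dτ`. -/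
theorem schwarzian_integral_identity (h : ℝ → ℝ)
    (hh : ContDiffOn ℝ 3 h (Icc 0 1))
    (hpos : ∀ t ∈ Icc (0 : ℝ) 1, 0 < derivWithin h (Icc 0 1) t)
    (h1 : derivWithin h (Icc 0 1) 0 = derivWithin h (Icc 0 1) 1)
    (h2 : derivWithin (derivWithin h (Icc 0 1)) (Icc 0 1) 0
        = derivWithin (derivWithin h (Icc 0 1)) (Icc 0 1) 1) :
    ∫ τ in (0 : ℝ)..1, schwarzianWithin h (Icc 0 1) τ / derivWithin h (Icc 0 1) τ
      = (1 / 2) * ∫ τ in (0 : ℝ)..1,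
          (derivWithin (derivWithin h (Icc 0 1)) (Icc 0 1) τ) ^ 2
            / (derivWithin h (Icc 0 1) τ) ^ 3 := by
  set s : Set ℝ := Icc 0 1
  have hu : UniqueDiffOn ℝ s := uniqueDiffOn_Icc zero_lt_one
  have c1 : ContDiffOn ℝ 2 (derivWithin h s) s := hh.derivWithin hu (by norm_num)
  have c2 : ContDiffOn ℝ 1 (derivWithin (derivWithin h s) s) s :=
    c1.derivWithin hu (by norm_num)
  have c3 : ContinuousOn (derivWithin (derivWithin (derivWithin h s) s) s) s :=
    c2.continuousOn_derivWithin hu le_rfl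
  set p := derivWithin h s
  set q := derivWithin p s
  set r := derivWithin q s
  have hne : ∀ t ∈ s, p t ≠ 0 := fun t ht => (hpos t ht).ne'
  have huIcc : uIcc (0 : ℝ) 1 = s := uIcc_of_le zero_le_one
  have i1 : IntervalIntegrable (fun t => q t ^ 2 / p t ^ 3) MeasureTheory.volume 0 1 := by
    apply ContinuousOn.intervalIntegrable
    rw [huIcc]
    exact (c2.continuousOn.pow 2).div (c1.continuousOn.pow 3) fun t ht => pow_ne_zero 3 (hne t ht)
  have i2 : IntervalIntegrable (fun t => r t / p t ^ 2 - 2 * (q t ^ 2 / p t ^ 3))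
      MeasureTheory.volume 0 1 := by
    refine IntervalIntegrable.sub (ContinuousOn.intervalIntegrable ?_) (i1.const_mul 2)
    rw [huIcc]
    exact c3.div (c1.continuousOn.pow 2) fun t ht => pow_ne_zero 2 (hne t ht)
  have hftc : ∫ t in (0 : ℝ)..1, (r t / p t ^ 2 - 2 * (q t ^ 2 / p t ^ 3)) = 0 := by
    rw [intervalIntegral.integral_eq_sub_of_hasDerivAt_of_le (f := fun t => q t / p t ^ 2)
      zero_le_one ?_ ?_ i2, h1, h2, sub_self]
    · exact c2.continuousOn.div (c1.continuousOn.pow 2) fun t ht => pow_ne_zero 2 (hne t ht)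
    · intro t ht
      have hmem : t ∈ s := Ioo_subset_Icc_self ht
      have hnhds : s ∈ nhds t := Icc_mem_nhds ht.1 ht.2
      have dp : HasDerivAt p (q t) t :=
        (c1.differentiableOn (by norm_num) t hmem).hasDerivWithinAt.hasDerivAt hnhds
      have dq : HasDerivAt q (r t) t :=
        (c2.differentiableOn (by norm_num) t hmem).hasDerivWithinAt.hasDerivAt hnhds
      have hp := hne t hmem
      refine (dq.fun_div (dp.fun_pow 2) (pow_ne_zero 2 hp)).congr_deriv ?_
      push_cast
      field_simp
  have hsplit : ∀ t ∈ uIcc (0 : ℝ) 1, schwarzianWithin h s t / p t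
      = (r t / p t ^ 2 - 2 * (q t ^ 2 / p t ^ 3)) + (1 / 2) * (q t ^ 2 / p t ^ 3) := by
    intro t ht
    rw [huIcc] at ht
    have hp := hne t ht
    change (r t / p t - (3 / 2) * (q t / p t) ^ 2) / p t = _
    field_simp
    ring
  rw [intervalIntegral.integral_congr hsplit,
    intervalIntegral.integral_add i2 (i1.const_mul _), hftc, zero_add,
    intervalIntegral.integral_const_mul]
end

section
/- Let Y be a topological space, X a Polish space, and {ν^y}_{y∈Y} a family of Borel measures on X that is continuous in y. If F: X → [0, ∞) is a continuous function, then the family of Borel measures {F·ν^y}_{y∈Y} (where F·ν^y denotes the measure with density F with respect to ν^y) is also continuous in y. -/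
open MeasureTheory

/-- A family of Borel measures `ν y` on a Polish space `X`, indexed by a topological
space `Y`, is continuous in `y`: there is a family of open sets `U a` covering `X`,
each of uniformly bounded measure, such that for every bounded continuous nonnegative
`F` vanishing outside some `U a`, the map `y ↦ ∫ F dν^y` is continuous. -/
def MeasFamilyCont {Y : Type} [TopologicalSpace Y] {X : Type} [TopologicalSpace X]
    [MeasurableSpace X] (ν : Y → Measure X) : Prop :=
  ∃ (ι : Type) (U : ι → Set X),
    (∀ a, IsOpen (U a)) ∧
    (⋃ a, U a) = Set.univ ∧
    (∀ a, ∃ M : ℝ, 0 < M ∧ ∀ y, ν y (U a) < ENNReal.ofReal M) ∧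
    (∀ a (F : X → ℝ), Continuous F → (∀ x, 0 ≤ F x) → (∃ C : ℝ, ∀ x, F x ≤ C) →
      (∀ x, x ∉ U a → F x = 0) → Continuous fun y => ∫ x, F x ∂(ν y))

/-- If `{ν^y}` is a continuous family of Borel measures on a Polish space and
`F : X → [0,∞)` is continuous, then `{F·ν^y}` is also a continuous family. -/
theorem measFamilyCont_withDensity {Y : Type} [TopologicalSpace Y]
    {X : Type} [TopologicalSpace X] [PolishSpace X] [MeasurableSpace X] [BorelSpace X]
    (ν : Y → Measure X) (hν : MeasFamilyCont ν)
    (F : X → ℝ) (hF : Continuous F) (hF0 : ∀ x, 0 ≤ F x) :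
    MeasFamilyCont fun y => (ν y).withDensity fun x => ENNReal.ofReal (F x) := by
  obtain ⟨ι, U, hUo, hUc, hUM, hUF⟩ := hν
  refine ⟨ι × ℕ, fun p => U p.1 ∩ F ⁻¹' Set.Iio ((p.2 : ℝ) + 1),
    fun p => (hUo p.1).inter (isOpen_Iio.preimage hF), ?_, ?_, ?_⟩
  · refine Set.eq_univ_of_forall fun x => ?_
    obtain ⟨a, ha⟩ := Set.mem_iUnion.1 (hUc ▸ Set.mem_univ x)
    obtain ⟨n, hn⟩ := exists_nat_gt (F x)
    exact Set.mem_iUnion.2 ⟨(a, n), ha, hn.trans (lt_add_one _)⟩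
  · rintro ⟨a, n⟩
    obtain ⟨M, hM, hνM⟩ := hUM a
    have hn : (0 : ℝ) < (n : ℝ) + 1 := by positivity
    refine ⟨((n : ℝ) + 1) * M, by positivity, fun y => ?_⟩
    have hV : MeasurableSet (U a ∩ F ⁻¹' Set.Iio ((n : ℝ) + 1)) :=
      ((hUo a).inter (isOpen_Iio.preimage hF)).measurableSet
    calc (ν y).withDensity (fun x => ENNReal.ofReal (F x)) (U a ∩ F ⁻¹' Set.Iio ((n : ℝ) + 1))
        = ∫⁻ x in U a ∩ F ⁻¹' Set.Iio ((n : ℝ) + 1), ENNReal.ofReal (F x) ∂ν y :=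
          withDensity_apply _ hV
      _ ≤ ∫⁻ _ in U a ∩ F ⁻¹' Set.Iio ((n : ℝ) + 1), ENNReal.ofReal ((n : ℝ) + 1) ∂ν y :=
          setLIntegral_mono' hV fun x hx => ENNReal.ofReal_le_ofReal (le_of_lt hx.2)
      _ = ENNReal.ofReal ((n : ℝ) + 1) * ν y (U a ∩ F ⁻¹' Set.Iio ((n : ℝ) + 1)) :=
          setLIntegral_const _ _
      _ ≤ ENNReal.ofReal ((n : ℝ) + 1) * ν y (U a) := by gcongr; exact Set.inter_subset_left
      _ < ENNReal.ofReal ((n : ℝ) + 1) * ENNReal.ofReal M :=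
          (ENNReal.mul_lt_mul_iff_right (ENNReal.ofReal_pos.2 hn).ne' ENNReal.ofReal_ne_top).2
            (hνM y)
      _ = ENNReal.ofReal (((n : ℝ) + 1) * M) := (ENNReal.ofReal_mul hn.le).symm
  · rintro ⟨a, n⟩ G hG hG0 ⟨C, hC⟩ hGV
    have key : ∀ y, ∫ x, G x ∂(ν y).withDensity (fun x => ENNReal.ofReal (F x)) =
        ∫ x, F x * G x ∂ν y := fun y => by
      rw [integral_withDensity_eq_integral_toReal_smul hF.measurable.ennreal_ofReal
        (.of_forall fun _ => ENNReal.ofReal_lt_top)]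
      simp only [ENNReal.toReal_ofReal (hF0 _), smul_eq_mul]
    simp only [key]
    refine hUF a _ (hF.mul hG) (fun x => mul_nonneg (hF0 x) (hG0 x))
      ⟨((n : ℝ) + 1) * C, fun x => ?_⟩ fun x hx => ?_
    · by_cases hx : x ∈ U a ∩ F ⁻¹' Set.Iio ((n : ℝ) + 1)
      · exact mul_le_mul (le_of_lt hx.2) (hC x) (hG0 x) (by positivity)
      · rw [hGV x hx, mul_zero]
        exact mul_nonneg (by positivity) ((hG0 x).trans (hC x))
    · rw [hGV x fun h => hx h.1, mul_zero]
end

section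
/- Let X and Y be Polish spaces, π: X → Y a continuous map, and λ a Radon measure on Y. Suppose {ν^y}_{y∈Y} and {ν̃^y}_{y∈Y} are two families of Borel measures on X, each continuous in y, such that for every y ∈ Y the measures ν^y and ν̃^y are supported on the fiber π^{−1}(y), and such that the two disintegrations agree: for every bounded continuous F: X → [0, ∞), ∫_Y (∫_X F dν^y) dλ(y) = ∫_Y (∫_X F dν̃^y) dλ(y). Then ν^y = ν̃^y for every y in the topological support of λ. -/
open MeasureTheory

open Filter Topology

/-- Two measures that are finite on an open set `O` and give the same integral to every
nonnegative bounded continuous function vanishing outside `O` agree on `O`. -/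
theorem measure_isOpen_eq_of_forall_integral_eq {X : Type*} [TopologicalSpace X]
    [HasOuterApproxClosed X] [MeasurableSpace X] [BorelSpace X] {μ μ' : Measure X}
    {O : Set X} (hO : IsOpen O) (hμ : μ O ≠ ⊤) (hμ' : μ' O ≠ ⊤)
    (h : ∀ F : X → ℝ, Continuous F → (∀ x, 0 ≤ F x) → (∃ C : ℝ, ∀ x, F x ≤ C) →
      (∀ x, x ∉ O → F x = 0) → ∫ x, F x ∂μ = ∫ x, F x ∂μ') :
    μ O = μ' O := by
  have hcl : IsClosed Oᶜ := hO.isClosed_compl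
  set f : ℕ → X → ℝ := fun n x => 1 - ((hcl.apprSeq n x : NNReal) : ℝ) with hf
  have hf_le : ∀ n x, ((hcl.apprSeq n x : NNReal) : ℝ) ≤ 1 := fun n x => by
    exact_mod_cast HasOuterApproxClosed.apprSeq_apply_le_one hcl n x
  have hf_cont : ∀ n, Continuous (f n) := fun n => by
    simp only [hf]
    fun_prop
  have hf_zero : ∀ n x, x ∉ O → f n x = 0 := fun n x hx => by
    simp [hf, HasOuterApproxClosed.apprSeq_apply_eq_one hcl n (x := x) hx]
  have hf_nonneg : ∀ n x, 0 ≤ f n x := fun n x => sub_nonneg.2 (hf_le n x)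
  have hf_le_one : ∀ n x, f n x ≤ 1 := fun n x => sub_le_self _ (NNReal.coe_nonneg _)
  have hf_lim : ∀ x, Tendsto (fun n => f n x) atTop (𝓝 (O.indicator (fun _ => (1 : ℝ)) x)) := by
    intro x
    have h1 := tendsto_pi_nhds.1 (HasOuterApproxClosed.tendsto_apprSeq hcl) x
    have h2 := ((NNReal.continuous_coe.tendsto _).comp h1).const_sub 1
    have h3 : O.indicator (fun _ => (1 : ℝ)) x
        = 1 - ((Oᶜ.indicator (fun _ => (1 : NNReal)) x : NNReal) : ℝ) := by
      by_cases hx : x ∈ O <;> simp [hx]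
    rw [h3]
    exact h2
  have key : ∀ m : Measure X, m O ≠ ⊤ →
      Tendsto (fun n => ∫ x, f n x ∂m) atTop (𝓝 (m.real O)) := by
    intro m hm
    have h1 : ∫ x, O.indicator (fun _ => (1 : ℝ)) x ∂m = m.real O := by
      simpa using integral_indicator_const (μ := m) (1 : ℝ) hO.measurableSet
    rw [← h1]
    refine tendsto_integral_of_dominated_convergence (O.indicator fun _ => (1 : ℝ))
      (fun n => (hf_cont n).aestronglyMeasurable)
      ((integrable_indicator_iff hO.measurableSet).2 (integrableOn_const hm))
      (fun n => ae_of_all _ fun x => ?_) (ae_of_all _ hf_lim)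
    by_cases hx : x ∈ O
    · simpa [hx, abs_of_nonneg (hf_nonneg n x)] using hf_le_one n x
    · simp [hx, hf_zero n x hx]
  have hreal : μ.real O = μ'.real O := by
    refine tendsto_nhds_unique (key μ hμ) ((key μ' hμ').congr fun n => ?_)
    exact (h (f n) (hf_cont n) (hf_nonneg n) ⟨1, hf_le_one n⟩ (hf_zero n)).symm
  exact (ENNReal.toReal_eq_toReal_iff' hμ hμ').1 hreal

/-- An outer regular measure that is finite on compact sets is locally finite. -/
theorem MeasureTheory.Measure.exists_isOpen_measure_lt_top_of_outerRegular {Y : Type*}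
    [TopologicalSpace Y] [MeasurableSpace Y] (μ : Measure Y) [μ.OuterRegular]
    [IsFiniteMeasureOnCompacts μ] (y : Y) : ∃ V, IsOpen V ∧ y ∈ V ∧ μ V < ⊤ := by
  obtain ⟨V, hV, hVo, hlt⟩ :=
    Set.exists_isOpen_lt_of_lt {y} ⊤ ((isCompact_singleton (x := y)).measure_lt_top (μ := μ))
  exact ⟨V, hVo, hV rfl, hlt⟩

/-- If two continuous functions have the same integral against every nonnegative bounded
continuous weight, then the first is at most the second on the support of the measure. -/
theorem le_of_forall_integral_mul_eq {Y : Type*} [PseudoMetricSpace Y]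
    [MeasurableSpace Y] [BorelSpace Y] {μ : Measure Y} {G G' : Y → ℝ}
    (hG : Continuous G) (hG' : Continuous G')
    (h : ∀ w : Y → ℝ, Continuous w → (∀ y, 0 ≤ w y) → (∀ y, w y ≤ 1) →
      ∫ y, w y * G y ∂μ = ∫ y, w y * G' y ∂μ)
    {y₀ : Y} (hfin : ∃ V, IsOpen V ∧ y₀ ∈ V ∧ μ V < ⊤)
    (hy₀ : ∀ U : Set Y, IsOpen U → y₀ ∈ U → μ U ≠ 0) : G y₀ ≤ G' y₀ := by
  by_contra! hlt
  obtain ⟨V, hVo, hyV, hV⟩ := hfin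
  have hnhds : ∀ᶠ y in 𝓝 y₀, y ∈ V ∧ G' y < G y ∧ |G y| < |G y₀| + 1 ∧ |G' y| < |G' y₀| + 1 :=
    Eventually.and (hVo.mem_nhds hyV) <| (hG'.continuousAt.eventually_lt hG.continuousAt hlt).and <|
      (hG.abs.continuousAt.eventually_lt continuousAt_const (lt_add_one _)).and
        (hG'.abs.continuousAt.eventually_lt continuousAt_const (lt_add_one _))
  obtain ⟨ε, hε, hball⟩ := Metric.eventually_nhds_iff_ball.1 hnhds
  set w : Y → ℝ := fun y => max 0 (1 - dist y y₀ / ε) with hw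
  have hwc : Continuous w := by
    simp only [hw]
    fun_prop
  have hw0 : ∀ y, 0 ≤ w y := fun y => le_max_left _ _
  have hw1 : ∀ y, w y ≤ 1 := fun y =>
    max_le zero_le_one (sub_le_self _ (div_nonneg dist_nonneg hε.le))
  have hw_pos : ∀ y ∈ Metric.ball y₀ ε, 0 < w y := fun y hy =>
    lt_max_of_lt_right (sub_pos.2 ((div_lt_one hε).2 hy))
  have hw_zero : ∀ y ∉ Metric.ball y₀ ε, w y = 0 := fun y hy =>
    max_eq_left (sub_nonpos.2 ((one_le_div hε).2 (not_lt.1 hy)))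
  have hμball : μ (Metric.ball y₀ ε) ≠ ⊤ :=
    ((measure_mono fun y hy => (hball y hy).1).trans_lt hV).ne
  have hint : ∀ H : Y → ℝ, Continuous H → (∀ y ∈ Metric.ball y₀ ε, |H y| < |H y₀| + 1) →
      Integrable (fun y => w y * H y) μ := by
    intro H hH hb
    refine Integrable.mono' (g := (Metric.ball y₀ ε).indicator fun _ => |H y₀| + 1)
      ((integrable_indicator_iff Metric.isOpen_ball.measurableSet).2 (integrableOn_const hμball))
      (hwc.mul hH).aestronglyMeasurable (ae_of_all _ fun y => ?_)
    by_cases hy : y ∈ Metric.ball y₀ ε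
    · rw [Set.indicator_of_mem hy, Real.norm_eq_abs, abs_mul, abs_of_nonneg (hw0 y)]
      exact (mul_le_of_le_one_left (abs_nonneg _) (hw1 y)).trans (hb y hy).le
    · simp [hw_zero y hy, hy]
  have hi := hint G hG fun y hy => (hball y hy).2.2.1
  have hi' := hint G' hG' fun y hy => (hball y hy).2.2.2
  have hnonneg : ∀ y, 0 ≤ w y * G y - w y * G' y := fun y => by
    by_cases hy : y ∈ Metric.ball y₀ ε
    · rw [← mul_sub]
      exact mul_nonneg (hw0 y) (sub_nonneg.2 (hball y hy).2.1.le)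
    · simp [hw_zero y hy]
  have hzero : ∫ y, (w y * G y - w y * G' y) ∂μ = 0 := by
    rw [integral_sub hi hi', h w hwc hw0 hw1, sub_self]
  have hae := (integral_eq_zero_iff_of_nonneg hnonneg (hi.sub hi')).1 hzero
  refine hy₀ _ Metric.isOpen_ball (Metric.mem_ball_self hε)
    (measure_mono_null (fun y hy => ?_) (ae_iff.1 hae))
  have : 0 < w y * G y - w y * G' y := by
    rw [← mul_sub]
    exact mul_pos (hw_pos y hy) (sub_pos.2 (hball y hy).2.1)
  exact ne_of_gt this

/-- A function pulled back from the base factors out of the integral against a measure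
supported on a fiber. -/
theorem integral_comp_mul_of_fiber {X Y : Type*} [MeasurableSpace X] {μ : Measure X}
    {p : X → Y} {y : Y} (hμ : μ ((p ⁻¹' {y})ᶜ) = 0) (w : Y → ℝ) (F : X → ℝ) :
    ∫ x, w (p x) * F x ∂μ = w y * ∫ x, F x ∂μ := by
  rw [← integral_const_mul]
  refine integral_congr_ae ?_
  have hae : ∀ᵐ x ∂μ, x ∈ p ⁻¹' {y} := hμ
  filter_upwards [hae] with x hx
  rw [show p x = y from hx]

/-- Uniqueness of disintegration: two continuous families of Borel measures supported
on the fibers of a continuous projection `p : X → Y`, whose disintegrations against a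
Radon measure `lam` on `Y` agree, coincide at every point of the topological support
of `lam`. -/
theorem disintegration_unique {X Y : Type}
    [TopologicalSpace X] [PolishSpace X] [MeasurableSpace X] [BorelSpace X]
    [TopologicalSpace Y] [PolishSpace Y] [MeasurableSpace Y] [BorelSpace Y]
    (p : X → Y) (hp : Continuous p)
    (lam : Measure Y) (hlam : lam.Regular)
    (ν ν' : Y → Measure X)
    (hν : MeasFamilyCont ν) (hν' : MeasFamilyCont ν')
    (hsupp : ∀ y, ν y ((p ⁻¹' {y})ᶜ) = 0)
    (hsupp' : ∀ y, ν' y ((p ⁻¹' {y})ᶜ) = 0)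
    (hagree : ∀ F : X → ℝ, Continuous F → (∀ x, 0 ≤ F x) → (∃ C : ℝ, ∀ x, F x ≤ C) →
      ∫ y, (∫ x, F x ∂(ν y)) ∂lam = ∫ y, (∫ x, F x ∂(ν' y)) ∂lam) :
    ∀ y : Y, (∀ U : Set Y, IsOpen U → y ∈ U → lam U ≠ 0) → ν y = ν' y := by
  intro y₀ hy₀
  obtain ⟨ι, U, hUo, hUc, hUb, hUi⟩ := hν
  obtain ⟨ι', U', hUo', hUc', hUb', hUi'⟩ := hν'
  have hfin : ∃ V, IsOpen V ∧ y₀ ∈ V ∧ lam V < ⊤ :=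
    lam.exists_isOpen_measure_lt_top_of_outerRegular y₀
  have hWo : ∀ i : ι × ι', IsOpen (U i.1 ∩ U' i.2) := fun i => (hUo i.1).inter (hUo' i.2)
  have hintegral : ∀ (i : ι × ι') (F : X → ℝ), Continuous F → (∀ x, 0 ≤ F x) →
      (∃ C : ℝ, ∀ x, F x ≤ C) → (∀ x, x ∉ U i.1 ∩ U' i.2 → F x = 0) →
      ∫ x, F x ∂(ν y₀) = ∫ x, F x ∂(ν' y₀) := by
    intro i F hF hF0 ⟨C, hC⟩ hFv
    let _ := TopologicalSpace.upgradeIsCompletelyMetrizable Y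
    have hG := hUi i.1 F hF hF0 ⟨C, hC⟩ fun x hx => hFv x fun h => hx h.1
    have hG' := hUi' i.2 F hF hF0 ⟨C, hC⟩ fun x hx => hFv x fun h => hx h.2
    have hweight : ∀ w : Y → ℝ, Continuous w → (∀ y, 0 ≤ w y) → (∀ y, w y ≤ 1) →
        ∫ y, w y * ∫ x, F x ∂(ν y) ∂lam = ∫ y, w y * ∫ x, F x ∂(ν' y) ∂lam := by
      intro w hw hw0 hw1
      have h := hagree (fun x => w (p x) * F x) ((hw.comp hp).mul hF)
        (fun x => mul_nonneg (hw0 _) (hF0 x))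
        ⟨C, fun x => (mul_le_of_le_one_left (hF0 x) (hw1 _)).trans (hC x)⟩
      simpa only [integral_comp_mul_of_fiber (hsupp _), integral_comp_mul_of_fiber (hsupp' _)]
        using h
    exact le_antisymm (le_of_forall_integral_mul_eq hG hG' hweight hfin hy₀)
      (le_of_forall_integral_mul_eq hG' hG (fun w h h0 h1 => (hweight w h h0 h1).symm) hfin hy₀)
  have hν_fin : ∀ i : ι × ι', ν y₀ (U i.1 ∩ U' i.2) < ⊤ := fun i => by
    obtain ⟨M, -, hM⟩ := hUb i.1
    exact (measure_mono Set.inter_subset_left).trans_lt ((hM y₀).trans ENNReal.ofReal_lt_top)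
  have hν_fin' : ∀ i : ι × ι', ν' y₀ (U i.1 ∩ U' i.2) < ⊤ := fun i => by
    obtain ⟨M, -, hM⟩ := hUb' i.2
    exact (measure_mono Set.inter_subset_right).trans_lt ((hM y₀).trans ENNReal.ofReal_lt_top)
  let _ := TopologicalSpace.upgradeIsCompletelyMetrizable X
  have hopen : ∀ (i : ι × ι') (O : Set X), IsOpen O → O ⊆ U i.1 ∩ U' i.2 → ν y₀ O = ν' y₀ O :=
    fun i O hO hsub => measure_isOpen_eq_of_forall_integral_eq hO
      ((measure_mono hsub).trans_lt (hν_fin i)).ne ((measure_mono hsub).trans_lt (hν_fin' i)).ne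
      fun F hF hF0 hFb hFv => hintegral i F hF hF0 hFb fun x hx => hFv x fun h => hx (hsub h)
  have hrestrict : ∀ i : ι × ι',
      (ν y₀).restrict (U i.1 ∩ U' i.2) = (ν' y₀).restrict (U i.1 ∩ U' i.2) := by
    intro i
    have : IsFiniteMeasure ((ν y₀).restrict (U i.1 ∩ U' i.2)) :=
      isFiniteMeasure_restrict.2 (hν_fin i).ne
    refine ext_of_generate_finite {s | IsOpen s} (BorelSpace.measurable_eq (α := X))
      isPiSystem_isOpen (fun s hs => ?_) ?_
    · rw [Measure.restrict_apply hs.measurableSet, Measure.restrict_apply hs.measurableSet]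
      exact hopen i _ (IsOpen.inter hs (hWo i)) Set.inter_subset_right
    · simpa using hopen i _ (hWo i) subset_rfl
  have hcover : ⋃ i : ι × ι', U i.1 ∩ U' i.2 = Set.univ := by
    refine Set.eq_univ_of_forall fun x => ?_
    obtain ⟨a, ha⟩ := Set.mem_iUnion.1 (hUc ▸ Set.mem_univ x)
    obtain ⟨b, hb⟩ := Set.mem_iUnion.1 (hUc' ▸ Set.mem_univ x)
    exact Set.mem_iUnion.2 ⟨(a, b), ha, hb⟩
  obtain ⟨T, hT, hTU⟩ := TopologicalSpace.isOpen_iUnion_countable _ hWo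
  refine (Measure.ext_iff_of_biUnion_eq_univ hT (hTU.trans hcover)).2 fun i _ => hrestrict i
end
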